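/- Let Ω₀ ⊆ Ω₁ ⊆ [0,1)^d be Lebesgue measurable sets with |Ω₁| > 0, let γ₀ ∈ ℤ^d be nonzero, and set Ω = Ω₁ ∪ (γ₀ + Ω₀). Let a₂, …, a_m ∈ ℝ^d and set S = 1 + ∑_{j=2}^m e^{2πi⟨a_j, γ₀⟩}. If ⟨a_j, γ₀⟩ ∉ ℤ for at least one j ∈ {2,…,m} (equivalently, |S| < m), then the family of exponentials {x ↦ e^{2πi⟨k,x⟩} : k ∈ ℤ^d} ∪ {x ↦ e^{2πi⟨a_j+k, x⟩} : 2 ≤ j ≤ m, k ∈ ℤ^d}, restricted to Ω, is a frame of L²(Ω) with frame bounds A = m − |S| and B = m + |S|. -/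

import Mathlib

open MeasureTheory ENNReal

/-- A family `φ i : α → ℂ` of functions is a frame for `L²(μ)` with frame bounds `A ≤ B`. -/
def IsFrameWith {α : Type*} [MeasurableSpace α] (μ : Measure α) {I : Type*}
    (φ : I → α → ℂ) (A B : ℝ) : Prop :=
  ∀ f : Lp ℂ 2 μ,
    A * ‖f‖ ^ 2 ≤ (∑' i : I, ‖∫ x, f x * (starRingEnd ℂ) (φ i x) ∂μ‖ ^ 2) ∧
    (∑' i : I, ‖∫ x, f x * (starRingEnd ℂ) (φ i x) ∂μ‖ ^ 2) ≤ B * ‖f‖ ^ 2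

/-- The exponential `x ↦ e^{2πi⟨b, x⟩}` on `ℝ^d`. -/
noncomputable def expChar {d : ℕ} (b : Fin d → ℝ) : (Fin d → ℝ) → ℂ :=
  fun x => Complex.exp (2 * Real.pi * Complex.I * (∑ i, b i * x i))

/-- The fundamental domain `[0,1)^d` of `ℤ^d` in `ℝ^d`. -/
def unitBox (d : ℕ) : Set (Fin d → ℝ) := Set.univ.pi fun _ => Set.Ico (0 : ℝ) 1

theorem continuous_expChar {d : ℕ} (b : Fin d → ℝ) : Continuous (expChar b) := by
  unfold expChar
  fun_prop

theorem norm_expChar {d : ℕ} (b x : Fin d → ℝ) : ‖expChar b x‖ = 1 := by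
  have h : 2 * (Real.pi : ℂ) * Complex.I * ((∑ i, b i * x i : ℝ) : ℂ)
      = ((2 * Real.pi * ∑ i, b i * x i : ℝ) : ℂ) * Complex.I := by
    push_cast
    ring
  rw [expChar, h, Complex.norm_exp_ofReal_mul_I]

theorem expChar_add_left {d : ℕ} (b c x : Fin d → ℝ) :
    expChar (b + c) x = expChar b x * expChar c x := by
  simp only [expChar, ← Complex.exp_add, Pi.add_apply, add_mul, Finset.sum_add_distrib,
    Complex.ofReal_add, mul_add]

theorem expChar_add_right {d : ℕ} (b x y : Fin d → ℝ) :
    expChar b (x + y) = expChar b x * expChar b y := by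
  simp only [expChar, ← Complex.exp_add, Pi.add_apply, mul_add, Finset.sum_add_distrib,
    Complex.ofReal_add]

theorem expChar_intCast {d : ℕ} (k n : Fin d → ℤ) :
    expChar (fun i => (k i : ℝ)) (fun i => (n i : ℝ)) = 1 := by
  rw [expChar, Complex.exp_eq_one_iff]
  refine ⟨∑ i, k i * n i, ?_⟩
  push_cast
  ring

theorem measurableSet_unitBox (d : ℕ) : MeasurableSet (unitBox d) :=
  MeasurableSet.univ_pi fun _ => measurableSet_Ico

instance isFiniteMeasure_restrict_unitBox (d : ℕ) :
    IsFiniteMeasure (volume.restrict (unitBox d)) := by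
  refine ⟨?_⟩
  rw [Measure.restrict_apply_univ, unitBox, volume_pi, Measure.pi_pi]
  simp

theorem integrable_mul_conj_expChar {d : ℕ} {μ : Measure (Fin d → ℝ)} {f : (Fin d → ℝ) → ℂ}
    (hf : Integrable f μ) (b : Fin d → ℝ) :
    Integrable (fun x => f x * (starRingEnd ℂ) (expChar b x)) μ :=
  hf.mul_bdd (c := 1) (Complex.continuous_conj.comp (continuous_expChar b)).aestronglyMeasurable
    (.of_forall fun x => by simp [norm_expChar])

section Parseval

attribute [local instance] instMeasureSpaceUnitAddCircle

/-- Parseval's identity for the Fourier series of a square-integrable function on `[0,1)^d`. -/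
theorem hasSum_sq_fourierCoeff_unitBox {d : ℕ} {g : (Fin d → ℝ) → ℂ}
    (hg : MemLp g 2 (volume.restrict (unitBox d))) :
    HasSum (fun k : Fin d → ℤ =>
        ‖∫ x in unitBox d, g x * (starRingEnd ℂ) (expChar (fun i => (k i : ℝ)) x)‖ ^ 2)
      (∫ x in unitBox d, ‖g x‖ ^ 2) := by
  set s : Set (Fin d → ℝ) := {x | ∀ i, x i ∈ Set.Ioc ((0 : Fin d → ℝ) i) ((0 : Fin d → ℝ) i + 1)}
    with hs
  have hs_pi : s = Set.univ.pi fun _ => Set.Ioc (0 : ℝ) 1 := by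
    ext x
    simp [hs, Set.mem_pi]
  have hs_meas : MeasurableSet s := hs_pi ▸ MeasurableSet.univ_pi fun _ => measurableSet_Ioc
  have hs_ae : unitBox d =ᵐ[volume] s := by
    rw [hs_pi, unitBox, volume_pi]
    exact Measure.univ_pi_Ico_ae_eq_Icc.trans Measure.univ_pi_Ioc_ae_eq_Icc.symm
  rw [Measure.restrict_congr_set hs_ae] at hg ⊢
  let σ : UnitAddTorus (Fin d) → (Fin d → ℝ) :=
    fun t => (UnitAddTorus.measurableEquivPiIoc (0 : Fin d → ℝ) t).1
  have hσ_emb : MeasurableEmbedding σ :=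
    (MeasurableEmbedding.subtype_coe hs_meas).comp
      (UnitAddTorus.measurableEquivPiIoc (0 : Fin d → ℝ)).measurableEmbedding
  have hσ : MeasurePreserving σ volume (volume.restrict s) :=
    MeasurePreserving.comp ⟨measurable_subtype_coe, map_comap_subtype_coe hs_meas volume⟩
      (UnitAddTorus.measurePreserving_equivPiIoc (0 : Fin d → ℝ))
  have hσ_coe (t : UnitAddTorus (Fin d)) (i : Fin d) : ((σ t i : ℝ) : UnitAddCircle) = t i :=
    congrFun ((UnitAddTorus.measurableEquivPiIoc (0 : Fin d → ℝ)).symm_apply_apply t) i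
  have hchar (k : Fin d → ℤ) (t : UnitAddTorus (Fin d)) :
      UnitAddTorus.mFourier k t = expChar (fun i => (k i : ℝ)) (σ t) := by
    simp only [UnitAddTorus.mFourier, ContinuousMap.coe_mk, expChar]
    rw [Complex.ofReal_sum, Finset.mul_sum, Complex.exp_sum]
    refine Finset.prod_congr rfl fun i _ => ?_
    rw [← hσ_coe t i, fourier_coe_apply]
    congr 1
    push_cast
    ring
  have hgσ := hg.comp_measurePreserving hσ
  have key := UnitAddTorus.hasSum_sq_mFourierCoeff (hgσ.toLp _)
  have hnorm : ∫ t, ‖hgσ.toLp _ t‖ ^ 2 = ∫ x in s, ‖g x‖ ^ 2 := by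
    rw [← hσ.integral_comp hσ_emb fun x => ‖g x‖ ^ 2]
    refine integral_congr_ae ?_
    filter_upwards [hgσ.coeFn_toLp] with t ht
    rw [ht, Function.comp_apply]
  have hcoeff (k : Fin d → ℤ) : UnitAddTorus.mFourierCoeff (hgσ.toLp _) k
      = ∫ x in s, g x * (starRingEnd ℂ) (expChar (fun i => (k i : ℝ)) x) := by
    rw [← hσ.integral_comp hσ_emb
      fun x => g x * (starRingEnd ℂ) (expChar (fun i => (k i : ℝ)) x), UnitAddTorus.mFourierCoeff]
    refine integral_congr_ae ?_
    filter_upwards [hgσ.coeFn_toLp] with t ht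
    rw [ht, Function.comp_apply, UnitAddTorus.mFourier_neg, hchar, smul_eq_mul, mul_comm]
  simpa only [hnorm, hcoeff] using key

end Parseval

theorem MeasureTheory.Lp.norm_sq_eq_integral {α : Type*} [MeasurableSpace α] {μ : Measure α}
    (f : Lp ℂ 2 μ) : ‖f‖ ^ 2 = ∫ x, ‖f x‖ ^ 2 ∂μ := by
  have h := L2.inner_def (𝕜 := ℂ) f f
  simp only [inner_self_eq_norm_sq_to_K] at h
  rw [← Complex.ofReal_inj]
  push_cast [← integral_complex_ofReal]
  simpa using h

/-- Sums of squared norms of rotated combinations of two vectors differ from `m (‖u‖² + ‖v‖²)` by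
at most `|∑ wⱼ| (‖u‖² + ‖v‖²)`. -/
theorem abs_sum_norm_add_mul_sq_sub_le {m : ℕ} (w : Fin m → ℂ) (hw : ∀ j, ‖w j‖ = 1) (u v : ℂ) :
    |∑ j, ‖u + w j * v‖ ^ 2 - m * (‖u‖ ^ 2 + ‖v‖ ^ 2)| ≤ ‖∑ j, w j‖ * (‖u‖ ^ 2 + ‖v‖ ^ 2) := by
  have hexp (j : Fin m) : ‖u + w j * v‖ ^ 2
      = (‖u‖ ^ 2 + ‖v‖ ^ 2) + 2 * (u * (starRingEnd ℂ) (w j * v)).re := by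
    rw [Complex.sq_norm, Complex.normSq_add, ← Complex.sq_norm, ← Complex.sq_norm, norm_mul, hw,
      one_mul]
  have hsum : ∑ j, ‖u + w j * v‖ ^ 2 - m * (‖u‖ ^ 2 + ‖v‖ ^ 2)
      = 2 * (u * (starRingEnd ℂ) ((∑ j, w j) * v)).re := by
    simp only [hexp, Finset.sum_add_distrib, Finset.sum_const, Finset.card_univ, Fintype.card_fin,
      nsmul_eq_mul, Finset.sum_mul, map_sum, Finset.mul_sum, Complex.re_sum]
    ring
  rw [hsum, abs_mul, abs_two]
  have hre := Complex.abs_re_le_norm (u * (starRingEnd ℂ) ((∑ j, w j) * v))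
  rw [norm_mul, Complex.norm_conj, norm_mul] at hre
  nlinarith [mul_nonneg (norm_nonneg (∑ j, w j)) (sq_nonneg (‖u‖ - ‖v‖))]

/-- A nontrivial integer translate of a subset of `[0,1)^d` is disjoint from `[0,1)^d`. -/
theorem disjoint_unitBox_intTranslate {d : ℕ} {γ : Fin d → ℤ} (hγ : γ ≠ 0)
    {s t : Set (Fin d → ℝ)} (hs : s ⊆ unitBox d) (ht : t ⊆ unitBox d) :
    Disjoint s {x | (fun i => x i - (γ i : ℝ)) ∈ t} := by
  rw [Set.disjoint_left]
  intro x hx hxt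
  apply hγ
  funext i
  have h₁ := hs hx i (Set.mem_univ i)
  have h₂ := ht hxt i (Set.mem_univ i)
  simp only [Set.mem_Ico] at h₁ h₂
  have h₃ : (γ i : ℝ) < 1 := by linarith
  have h₄ : (-1 : ℝ) < γ i := by linarith
  have h₅ : γ i < 1 := by exact_mod_cast h₃
  have h₆ : -1 < γ i := by exact_mod_cast h₄
  simp only [Pi.zero_apply]
  omega

section Translate

variable {d : ℕ} {s t B : Set (Fin d → ℝ)} (c : Fin d → ℝ)

theorem translate_preimage :
    (fun x => x + c) ⁻¹' {x | (fun i => x i - c i) ∈ t} = t := by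
  ext x
  simp

theorem measurableSet_translate (ht : MeasurableSet t) :
    MeasurableSet {x : Fin d → ℝ | (fun i => x i - c i) ∈ t} :=
  ht.preimage (f := fun x : Fin d → ℝ => fun i => x i - c i) (by fun_prop)

theorem measurePreserving_restrict_translate :
    MeasurePreserving (fun x => x + c) (volume.restrict t)
      (volume.restrict {x | (fun i => x i - c i) ∈ t}) := by
  have h := (measurePreserving_add_right (volume : Measure (Fin d → ℝ)) c).restrict_preimage_emb
    (measurableEmbedding_addRight c) {x | (fun i => x i - c i) ∈ t}
  rwa [translate_preimage c] at h

/-- An integral over `s ∪ (c + t)` is folded to an integral over any set containing `s` and `t`. -/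
theorem setIntegral_union_translate {E : Type*} [NormedAddCommGroup E] [NormedSpace ℝ E]
    (hs : MeasurableSet s) (ht : MeasurableSet t) (hsB : s ⊆ B) (htB : t ⊆ B)
    (hdisj : Disjoint s {x | (fun i => x i - c i) ∈ t}) {h : (Fin d → ℝ) → E}
    (hh : IntegrableOn h (s ∪ {x | (fun i => x i - c i) ∈ t})) :
    ∫ x in s ∪ {x | (fun i => x i - c i) ∈ t}, h x
      = ∫ x in B, (s.indicator h x + t.indicator (fun x => h (x + c)) x) := by
  have hτ := measurePreserving_restrict_translate c (t := t)
  have hemb := measurableEmbedding_addRight c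
  have hht : IntegrableOn (fun x => h (x + c)) t :=
    (hτ.integrable_comp_emb hemb).2 hh.right_of_union
  rw [setIntegral_union hdisj (measurableSet_translate c ht) hh.left_of_union hh.right_of_union,
    integral_add (hh.left_of_union.integrable_indicator hs).integrableOn
      (hht.integrable_indicator ht).integrableOn,
    setIntegral_indicator hs, setIntegral_indicator ht, Set.inter_eq_right.2 hsB,
    Set.inter_eq_right.2 htB, ← hτ.integral_comp hemb]

end Translate

theorem tsum_prod_eq_sum_of_hasSum {α β : Type*} [Fintype α] {F : α × β → ℝ} {t : α → ℝ}
    (hF : 0 ≤ F) (h : ∀ j, HasSum (fun k => F (j, k)) (t j)) : ∑' p, F p = ∑ j, t j := by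
  rw [Summable.tsum_prod ((summable_prod_of_nonneg hF).2
    ⟨fun j => (h j).summable, (hasSum_fintype _).summable⟩), tsum_fintype]
  exact Finset.sum_congr rfl fun j _ => (h j).tsum_eq

/-- Example: for `Ω = Ω₁ ∪ (γ₀ + Ω₀)` with `Ω₀ ⊆ Ω₁ ⊆ [0,1)^d` and `0 ≠ γ₀ ∈ ℤ^d`, if
`a₁ = 0` and `⟨a_j, γ₀⟩ ∉ ℤ` for some `j`, then the exponentials `e^{2πi⟨a_j + k, ·⟩}`,
`1 ≤ j ≤ m`, `k ∈ ℤ^d`, form a frame of `L²(Ω)` with frame bounds `m - |S|` and `m + |S|`,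
where `S = ∑ⱼ e^{2πi⟨a_j, γ₀⟩}`. -/
theorem example_frame_bounds
    (d m : ℕ) [NeZero m]
    (Ω₀ Ω₁ : Set (Fin d → ℝ)) (hΩ₀meas : MeasurableSet Ω₀) (hΩ₁meas : MeasurableSet Ω₁)
    (h01 : Ω₀ ⊆ Ω₁) (h1box : Ω₁ ⊆ unitBox d) (hΩ₁pos : 0 < volume Ω₁)
    (γ₀ : Fin d → ℤ) (hγ₀ : γ₀ ≠ 0)
    (a : Fin m → (Fin d → ℝ)) (ha0 : a 0 = 0)
    (hnotint : ∃ j : Fin m, ∀ n : ℤ, (∑ i, a j i * (γ₀ i : ℝ)) ≠ (n : ℝ)) :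
    IsFrameWith
      (volume.restrict (Ω₁ ∪ {x : Fin d → ℝ | (fun i => x i - (γ₀ i : ℝ)) ∈ Ω₀}))
      (fun p : Fin m × (Fin d → ℤ) => expChar (a p.1 + fun i => (p.2 i : ℝ)))
      ((m : ℝ) - ‖∑ j : Fin m, Complex.exp (2 * Real.pi * Complex.I * ∑ i, a j i * (γ₀ i : ℝ))‖)
      ((m : ℝ) + ‖∑ j : Fin m, Complex.exp (2 * Real.pi * Complex.I * ∑ i, a j i * (γ₀ i : ℝ))‖)
    := by
  let c : Fin d → ℝ := fun i => (γ₀ i : ℝ)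
  set Ω : Set (Fin d → ℝ) := Ω₁ ∪ {x : Fin d → ℝ | (fun i => x i - (γ₀ i : ℝ)) ∈ Ω₀}
  intro f
  beta_reduce
  have h0box : Ω₀ ⊆ unitBox d := h01.trans h1box
  have hdisj := disjoint_unitBox_intTranslate hγ₀ h1box h0box
  have hfold {E : Type} [NormedAddCommGroup E] [NormedSpace ℝ E] {h : (Fin d → ℝ) → E}
      (hh : IntegrableOn h Ω) := setIntegral_union_translate c hΩ₁meas hΩ₀meas h1box h0box hdisj hh
  have hfL : MemLp f 2 (volume.restrict Ω) := Lp.memLp f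
  have hfsq : IntegrableOn (fun x => ‖f x‖ ^ 2) Ω := hfL.integrable_norm_pow two_ne_zero
  let u : (Fin d → ℝ) → ℂ := Ω₁.indicator f
  let v : (Fin d → ℝ) → ℂ := Ω₀.indicator fun x => f (x + c)
  have hu : MemLp u 2 (volume.restrict (unitBox d)) :=
    ((memLp_indicator_iff_restrict hΩ₁meas).2
      (hfL.mono_measure (Measure.restrict_mono_set _ Set.subset_union_left))).restrict _
  have hv : MemLp v 2 (volume.restrict (unitBox d)) :=
    ((memLp_indicator_iff_restrict hΩ₀meas).2
      ((hfL.mono_measure (Measure.restrict_mono_set _ Set.subset_union_right)).comp_measurePreserving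
        (measurePreserving_restrict_translate c))).restrict _
  have hnorm : ‖f‖ ^ 2 = ∫ x in unitBox d, (‖u x‖ ^ 2 + ‖v x‖ ^ 2) := by
    rw [Lp.norm_sq_eq_integral, hfold hfsq]
    congr 1 with x
    by_cases h₁ : x ∈ Ω₁ <;> by_cases h₀ : x ∈ Ω₀ <;> simp [u, v, h₁, h₀]
  let w : Fin m → ℂ := fun j => (starRingEnd ℂ) (expChar (a j) c)
  have hw (j : Fin m) : ‖w j‖ = 1 := by simp [w, norm_expChar]
  have hwsum : ‖∑ j : Fin m, Complex.exp (2 * Real.pi * Complex.I *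
      ((∑ i, a j i * (γ₀ i : ℝ) : ℝ) : ℂ))‖ = ‖∑ j, w j‖ := by
    rw [← Complex.norm_conj, map_sum]
    rfl
  let e : Fin m → (Fin d → ℝ) → ℂ := fun j x => (starRingEnd ℂ) (expChar (a j) x)
  have he (j : Fin m) (x : Fin d → ℝ) : ‖e j x‖ = 1 := by simp [e, norm_expChar]
  let g : Fin m → (Fin d → ℝ) → ℂ := fun j x => e j x * (u x + w j * v x)
  have hgnorm (j : Fin m) (x : Fin d → ℝ) : ‖g j x‖ = ‖u x + w j * v x‖ := by
    simp only [g, norm_mul, he, one_mul]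
  have hg (j : Fin m) : MemLp (g j) 2 (volume.restrict (unitBox d)) := by
    have huv : MemLp (fun x => u x + w j * v x) 2 (volume.restrict (unitBox d)) :=
      hu.add (hv.const_mul (w j))
    refine huv.of_le ?_ (.of_forall fun x => (hgnorm j x).le)
    exact (Complex.continuous_conj.comp (continuous_expChar (a j))).aestronglyMeasurable.mul
      huv.aestronglyMeasurable
  have hΩfin : IsFiniteMeasure (volume.restrict Ω) := by
    have hb := (isFiniteMeasure_restrict.1 (isFiniteMeasure_restrict_unitBox d))
    refine isFiniteMeasure_restrict.2 (measure_union_ne_top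
      (measure_ne_top_of_subset h1box hb) ?_)
    have hτ := (measurePreserving_restrict_translate c (t := Ω₀)).measure_preimage
      MeasurableSet.univ.nullMeasurableSet
    simp only [Set.preimage_univ, Measure.restrict_apply_univ] at hτ
    rw [← hτ]
    exact measure_ne_top_of_subset h0box hb
  have hcoeff (j : Fin m) (k : Fin d → ℤ) :
      ∫ x in Ω, f x * (starRingEnd ℂ) (expChar (a j + fun i => (k i : ℝ)) x)
        = ∫ x in unitBox d, g j x * (starRingEnd ℂ) (expChar (fun i => (k i : ℝ)) x) := by
    rw [hfold (integrable_mul_conj_expChar (hfL.integrable one_le_two) _)]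
    congr 1 with x
    by_cases h₁ : x ∈ Ω₁ <;> by_cases h₀ : x ∈ Ω₀ <;>
      simp [u, v, g, e, w, c, h₁, h₀, expChar_add_left, expChar_add_right, expChar_intCast] <;> ring
  have huv_int (j : Fin m) :
      Integrable (fun x => ‖u x + w j * v x‖ ^ 2) (volume.restrict (unitBox d)) := by
    simpa only [hgnorm] using (hg j).integrable_norm_pow two_ne_zero
  have htsum : ∑' p : Fin m × (Fin d → ℤ),
      ‖∫ x in Ω, f x * (starRingEnd ℂ) (expChar (a p.1 + fun i => (p.2 i : ℝ)) x)‖ ^ 2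
        = ∫ x in unitBox d, ∑ j, ‖u x + w j * v x‖ ^ 2 := by
    rw [integral_finsetSum _ fun j _ => huv_int j]
    refine tsum_prod_eq_sum_of_hasSum (fun p => sq_nonneg _) fun j => ?_
    have hsum := hasSum_sq_fourierCoeff_unitBox (hg j)
    simp only [hgnorm] at hsum
    simpa only [hcoeff] using hsum
  have hpow : Integrable (fun x => ‖u x‖ ^ 2 + ‖v x‖ ^ 2) (volume.restrict (unitBox d)) :=
    (hu.integrable_norm_pow two_ne_zero).add (hv.integrable_norm_pow two_ne_zero)
  have hsumint := integrable_finsetSum Finset.univ fun j _ => huv_int j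
  have hbound (x : Fin d → ℝ) := abs_le.1 (abs_sum_norm_add_mul_sq_sub_le w hw (u x) (v x))
  rw [htsum, hwsum, hnorm, ← integral_const_mul, ← integral_const_mul]
  exact ⟨integral_mono (hpow.const_mul _) hsumint fun x => by linarith [(hbound x).1],
    integral_mono hsumint (hpow.const_mul _) fun x => by linarith [(hbound x).2]⟩
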